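/- Assume that, for some l ∈ {1,2,…,k}, the averaged functions satisfy g_i ≡ 0 for i = 1,2,…,l−1 and g_l ≢ 0. Then, for each a* ∈ Ω such that g_l(a*) = 0 and det(D g_l(a*)) ≠ 0, there exists, for |ε| > 0 sufficiently small, a T-periodic solution φ(·,ε) of the standard-form system ẋ = Σ_{i=1}^k εⁱF_i(t,x) + ε^{k+1}F̃(t,x,ε) such that φ(0,ε) → a* as ε → 0. -/

import Mathlib

open Set Filter Topology intervalIntegral

noncomputable section

/-- Index set for the partial Bell polynomial `B_{p,q}`: tuples `(b₁,…,b_{p-q+1})`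
of nonnegative integers with `b₁ + 2b₂ + ⋯ = p` and `b₁ + ⋯ = q`. -/
def bellIdx (p q : ℕ) : Finset (Fin (p - q + 1) → Fin (p + 1)) :=
  Finset.univ.filter fun b =>
    (∑ j : Fin (p - q + 1), ((j : ℕ) + 1) * (b j : ℕ)) = p ∧
      (∑ j : Fin (p - q + 1), (b j : ℕ)) = q

/-- The coefficient `p! / (b₁! ⋯ b_{p-q+1}! (1!)^{b₁} ⋯ ((p-q+1)!)^{b_{p-q+1}})`. -/
def bellCoeff (p q : ℕ) (b : Fin (p - q + 1) → Fin (p + 1)) : ℝ :=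
  (p.factorial : ℝ) /
    ((∏ j : Fin (p - q + 1), ((b j : ℕ).factorial : ℝ)) *
      ∏ j : Fin (p - q + 1), ((((j : ℕ) + 1).factorial : ℝ)) ^ (b j : ℕ))

/-- The list of arguments `y₁,…,y₁,y₂,…` in which `y_j` is repeated `b_j` times. -/
def bellArgs {E : Type*} (p q : ℕ) (b : Fin (p - q + 1) → Fin (p + 1)) (v : ℕ → E) :
    List E :=
  (List.finRange (p - q + 1)).flatMap fun j => List.replicate (b j : ℕ) (v ((j : ℕ) + 1))

/-- The `q`-multilinear map `D` applied to the partial Bell polynomial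
`B_{p,q}(v 1, …, v (p-q+1))`; this is the term `∂^q F ⊙ B_{p,q}(y₁,…,y_{p-q+1})`. -/
def bellApplyD {E : Type*} [NormedAddCommGroup E] [NormedSpace ℝ E]
    (p q : ℕ) (D : ContinuousMultilinearMap ℝ (fun _ : Fin q => E) E) (v : ℕ → E) : E :=
  ∑ b ∈ bellIdx p q,
    bellCoeff p q b • D fun i => (bellArgs p q b v).getD (i : ℕ) 0

/-- `ySeq F i j` is the function `y_j` of the averaging recursion, computed after `i`
recursion steps (so it is meaningful for `j ≤ i`).  `y_0 = 0`, and
`y_i(t,x) = ∫₀ᵗ ( i! F_i(s,x) + ∑_{l=1}^{i-1} ∑_{m=1}^{l} (i!/l!) ∂^m F_{i-l}(s,x)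
B_{l,m}(y₁(s,x),…,y_{l-m+1}(s,x)) ) ds`. -/
def ySeq {E : Type*} [NormedAddCommGroup E] [NormedSpace ℝ E]
    (F : ℕ → ℝ → E → E) : ℕ → ℕ → ℝ → E → E
  | 0 => fun _ _ _ => 0
  | (i + 1) => fun j t x =>
      if j ≤ i then ySeq F i j t x
      else if j = i + 1 then
        ∫ s in (0 : ℝ)..t,
          ((((i + 1).factorial : ℝ)) • F (i + 1) s x +
            ∑ l ∈ Finset.Icc 1 i, ∑ m ∈ Finset.Icc 1 l,
              (((i + 1).factorial : ℝ) / (l.factorial : ℝ)) •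
                bellApplyD l m (iteratedFDeriv ℝ m (F (i + 1 - l) s) x)
                  (fun j' => ySeq F i j' s x))
      else 0

/-- The `i`-th averaged function `g_i(x) = y_i(T,x)/i!` of the system
`ẋ = ∑ εⁱ F_i(t,x)`. -/
def avgFun {E : Type*} [NormedAddCommGroup E] [NormedSpace ℝ E]
    (F : ℕ → ℝ → E → E) (T : ℝ) (i : ℕ) (x : E) : E :=
  ((i.factorial : ℝ))⁻¹ • ySeq F i i T x

theorem symm_swap {E : Type} [NormedAddCommGroup E] [NormedSpace ℝ E] (n : ℕ) :
   ∀ {F : Type} [NormedAddCommGroup F] [NormedSpace ℝ F] (f : E → F) (hf : ContDiff ℝ (⊤ : ℕ∞) f) (x : E) (v : Fin n → E)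
    (σ : Equiv.Perm (Fin n)), iteratedFDeriv ℝ n f x (v ∘ σ) = iteratedFDeriv ℝ n f x v := by
  induction n with
  | zero => intros; congr 1; ext i; exact i.elim0
  | succ n ih =>
    intro F _ _ f hf x v σ
    have hmem : σ ∈ Submonoid.closure (Set.range fun i : Fin n ↦ Equiv.swap i.castSucc i.succ) := by
      rw [Equiv.Perm.mclosure_swap_castSucc_succ]; trivial
    induction hmem using Submonoid.closure_induction generalizing v with
    | one => rfl
    | mul a b _ _ ha hb => rw [Equiv.Perm.coe_mul, ← Function.comp_assoc, hb, ha]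
    | mem s hs =>
      obtain ⟨i, rfl⟩ := hs
      have key1 : ∀ (τ : Equiv.Perm (Fin (n+1))) (τ' : Equiv.Perm (Fin n)), τ 0 = 0 → 
          (∀ j, τ (Fin.succ j) = Fin.succ (τ' j)) → 
          iteratedFDeriv ℝ (n+1) f x (v ∘ τ) = iteratedFDeriv ℝ (n+1) f x v := by
        intro τ τ' h0 h1
        have hd : DifferentiableAt ℝ (iteratedFDeriv ℝ n f) x := by
          apply hf.contDiffAt.differentiableAt_iteratedFDeriv
          exact_mod_cast (ENat.natCast_lt_top n)
        rw [hd.iteratedFDeriv_succ_apply_left', hd.iteratedFDeriv_succ_apply_left']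
        have : Fin.tail (v ∘ τ) = Fin.tail v ∘ τ' := by
          ext j; simp [Fin.tail, h1]
        simp only [this, Function.comp, h0]
        congr 2
        ext y
        exact ih f hf y _ τ'
      have key2 : ∀ (τ : Equiv.Perm (Fin (n+1))) (τ' : Equiv.Perm (Fin n)), τ (Fin.last n) = Fin.last n → 
          (∀ j, τ (Fin.castSucc j) = Fin.castSucc (τ' j)) → 
          iteratedFDeriv ℝ (n+1) f x (v ∘ τ) = iteratedFDeriv ℝ (n+1) f x v := by
        intro τ τ' h0 h1
        rw [iteratedFDeriv_succ_apply_right, iteratedFDeriv_succ_apply_right]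
        have : Fin.init (v ∘ τ) = Fin.init v ∘ τ' := by
          ext j; simp [Fin.init, h1]
        simp only [this, Function.comp, h0]
        have := ih (fun y => fderiv ℝ f y) (hf.fderiv_right (m := (⊤:ℕ∞)) (by simp)) x (Fin.init v) τ'
        exact DFunLike.congr_fun this _
      rcases n with _ | n
      · exact i.elim0
      · induction i using Fin.cases with
        | succ i => 
          apply key1 _ (Equiv.swap i.castSucc i.succ)
          · apply Equiv.swap_apply_of_ne_of_ne
            · exact (Fin.castSucc_ne_zero_iff.2 (Fin.succ_ne_zero i)).symm
            · exact (Fin.succ_ne_zero _).symm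
          · intro j
            have := (Fin.succ_injective (n+1)).swap_apply i.castSucc i.succ j
            simpa using this
        | zero =>
          rcases n with _ | n
          · have h2 : IsSymmSndFDerivAt ℝ f x := by
              apply hf.contDiffAt.isSymmSndFDerivAt
              simp only [minSmoothness_of_isRCLikeNormedField]; exact WithTop.coe_le_coe.2 (le_top : (2:ℕ∞) ≤ ⊤)
            rw [iteratedFDeriv_two_apply, iteratedFDeriv_two_apply]
            simpa using h2 _ _
          · apply key2 _ (Equiv.swap (0 : Fin (n+1)).castSucc (Fin.succ 0))
            · apply Equiv.swap_apply_of_ne_of_ne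
              · simp [Fin.ext_iff]
              · simp [Fin.ext_iff]
            · intro j
              have := (Fin.castSucc_injective (n+2)).swap_apply (0 : Fin (n+1)).castSucc (Fin.succ 0) j
              simpa using this

theorem contDiff_integral_nat {E : Type} [NormedAddCommGroup E] [NormedSpace ℝ E] [ProperSpace E] (n : ℕ) :
   ∀ {F : Type} [NormedAddCommGroup F] [NormedSpace ℝ F] [CompleteSpace F] (G : E × ℝ → F) (_ : ContDiff ℝ (⊤ : ℕ∞) G),
    ContDiff ℝ n (fun u => ∫ s in (0:ℝ)..1, G (u, s)) := by
  induction n with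
  | zero =>
    intro F _ _ _ G hG
    have := hG.continuous
    simp only [Nat.cast_zero, contDiff_zero]
    apply intervalIntegral.continuous_parametric_intervalIntegral_of_continuous'
    exact this
  | succ n ih =>
    intro F _ _ _ G hG
    have hG' : ContDiff ℝ (⊤ : ℕ∞) (fun w : E × ℝ => fderiv ℝ (fun u => G (u, w.2)) w.1) := by
      apply ContDiff.fderiv (m := (⊤:ℕ∞)) (n := (⊤:ℕ∞)) (f := fun (w : E × ℝ) u => G (u, w.2)) (g := fun w : E × ℝ => w.1)
      · fun_prop
      · fun_prop
      · simp
    have key : ∀ u, HasFDerivAt (fun u => ∫ s in (0:ℝ)..1, G (u, s)) (∫ s in (0:ℝ)..1, fderiv ℝ (fun u => G (u, s)) u) u := by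
      intro u
      have hc := hG.continuous
      have hc' := hG'.continuous
      obtain ⟨C, hC⟩ := ((isCompact_closedBall u 1).prod (isCompact_Icc (a := (0:ℝ)) (b := 1))).exists_bound_of_continuousOn hc'.continuousOn
      apply intervalIntegral.hasFDerivAt_integral_of_dominated_of_fderiv_le (s := Metric.closedBall u 1) (bound := fun _ => C) (F' := fun u s => fderiv ℝ (fun u => G (u, s)) u)
      · exact Metric.closedBall_mem_nhds u one_pos
      · refine Eventually.of_forall fun x => Continuous.aestronglyMeasurable ?_
        fun_prop
      · apply Continuous.intervalIntegrable; fun_prop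
      · exact Continuous.aestronglyMeasurable (hc'.comp (by fun_prop : Continuous fun s : ℝ => (u, s)))
      · refine Eventually.of_forall fun t ht x hx => hC (x, t) ⟨hx, ?_⟩
        rw [uIoc_of_le zero_le_one] at ht
        exact ⟨ht.1.le, ht.2⟩
      · simp
      · refine Eventually.of_forall fun t ht x hx => ?_
        apply DifferentiableAt.hasFDerivAt
        have : ContDiff ℝ (⊤ : ℕ∞) (fun u => G (u, t)) := by fun_prop
        exact this.contDiffAt.differentiableAt (by simp)
    push_cast
    rw [contDiff_succ_iff_fderiv]
    refine ⟨fun u => (key u).differentiableAt, by simp, ?_⟩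
    have : (fderiv ℝ fun u ↦ ∫ s in (0:ℝ)..1, G (u, s)) = fun u => ∫ s in (0:ℝ)..1, fderiv ℝ (fun u => G (u, s)) u := by
      ext1 u; exact (key u).fderiv
    rw [this]
    exact ih _ hG'

theorem contDiff_integral01 {E : Type} [NormedAddCommGroup E] [NormedSpace ℝ E] [ProperSpace E] 
   {F : Type} [NormedAddCommGroup F] [NormedSpace ℝ F] [CompleteSpace F] {G : E × ℝ → F} (h : ContDiff ℝ (⊤ : ℕ∞) G) :
    ContDiff ℝ (⊤:ℕ∞) (fun u => ∫ s in (0:ℝ)..1, G (u, s)) := 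
  contDiff_infty.2 fun n => contDiff_integral_nat n G h

theorem contDiff_primitive {E : Type} [NormedAddCommGroup E] [NormedSpace ℝ E] [ProperSpace E] 
   {F : Type} [NormedAddCommGroup F] [NormedSpace ℝ F] [CompleteSpace F] {G : ℝ × E → F} (h : ContDiff ℝ (⊤ : ℕ∞) G) :
    ContDiff ℝ (⊤:ℕ∞) (fun w : ℝ × E => ∫ s in (0:ℝ)..w.1, G (s, w.2)) := by
  have : (fun w : ℝ × E => ∫ s in (0:ℝ)..w.1, G (s, w.2)) = fun w => w.1 • ∫ s in (0:ℝ)..1, G (w.1 * s, w.2) := by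
    ext1 w
    have := intervalIntegral.smul_integral_comp_mul_left (a := 0) (b := 1) (fun s => G (s, w.2)) w.1
    simpa using this.symm
  rw [this]
  apply contDiff_fst.smul
  apply contDiff_integral01 (G := fun q : (ℝ × E) × ℝ => G (q.1.1 * q.2, q.1.2))
  fun_prop

theorem hadamard {E : Type} [NormedAddCommGroup E] [NormedSpace ℝ E] [ProperSpace E] 
   {F : Type} [NormedAddCommGroup F] [NormedSpace ℝ F] [CompleteSpace F] (m : ℕ) :
   ∀ (G : E × ℝ → F) (_ : ContDiff ℝ (⊤ : ℕ∞) G)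
   (_ : ∀ u, (fun e => G (u, e)) =O[𝓝 0] fun e : ℝ => e ^ m),
   ∃ N : E × ℝ → F, ContDiff ℝ (⊤:ℕ∞) N ∧ ∀ u e, G (u, e) = e ^ m • N (u, e) := by
  induction m with
  | zero => intro G h _; exact ⟨G, h, by simp⟩
  | succ m ih =>
    intro G h hO
    let P : E × ℝ → F := fun w => ∫ s in (0:ℝ)..1, fderiv ℝ (fun e => G (w.1, e)) (w.2 * s) 1
    have hP : ContDiff ℝ (⊤:ℕ∞) P := by
      apply contDiff_integral01 (G := fun q : (E × ℝ) × ℝ => fderiv ℝ (fun e => G (q.1.1, e)) (q.1.2 * q.2) 1)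
      refine ContDiff.clm_apply ?_ contDiff_const
      apply ContDiff.fderiv (m := (⊤:ℕ∞)) (n := (⊤:ℕ∞)) (f := fun (w : (E × ℝ) × ℝ) u => G (w.1.1, u)) (g := fun w => w.1.2 * w.2)
      · fun_prop
      · fun_prop
      · simp
    have h0 : ∀ u, G (u, 0) = 0 := by
      intro u
      obtain ⟨c, hc⟩ := (hO u).bound
      simpa using hc.self_of_nhds
    have hGP : ∀ u e, G (u, e) = e • P (u, e) := by
      intro u e
      have hu : ContDiff ℝ (⊤ : ℕ∞) (fun e => G (u, e)) := by fun_prop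
      have h1 := intervalIntegral.smul_integral_comp_mul_left (a := 0) (b := 1) (fun s => fderiv ℝ (fun e => G (u, e)) s 1) e
      simp only [P, h1]
      have h2 := intervalIntegral.integral_eq_sub_of_hasDerivAt (a := 0) (b := e) (f := fun e => G (u, e)) (f' := fun s => fderiv ℝ (fun e => G (u, e)) s 1)
        (fun x _ => by simpa using (hu.contDiffAt.differentiableAt (by simp)).hasFDerivAt.hasDerivAt) ?_
      · rw [mul_zero, mul_one, h2, h0, sub_zero]
      · apply Continuous.intervalIntegrable
        exact ((hu.continuous_fderiv (by simp)).clm_apply continuous_const)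
    obtain ⟨N, hN, hPN⟩ := ih P hP (by
      intro u
      have h3 : (fun e => P (u, e)) =O[𝓝[≠] 0] fun e : ℝ => e ^ m := by
        obtain ⟨c, hc⟩ := ((hO u).mono (nhdsWithin_le_nhds (s := {0}ᶜ))).bound
        apply Asymptotics.IsBigO.of_bound c
        filter_upwards [hc, self_mem_nhdsWithin] with e he hne
        rw [hGP, norm_smul, pow_succ, norm_mul, ← mul_assoc, mul_comm] at he
        exact le_of_mul_le_mul_right he (norm_pos_iff.2 hne)
      rcases Nat.eq_zero_or_pos m with rfl | hm
      · have hc : ContinuousAt (fun e => P (u, e)) 0 := (hP.continuous.comp (by fun_prop)).continuousAt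
        simpa using hc.isBigO_one ℝ
      · obtain ⟨c, hc⟩ := h3.bound
        have hz : P (u, 0) = 0 := by
          have ht : Tendsto (fun e => P (u, e)) (𝓝[≠] 0) (𝓝 0) := by
            apply h3.trans_tendsto
            have : Tendsto (fun e : ℝ => e ^ m) (𝓝 0) (𝓝 (0 ^ m)) := (continuous_pow m).tendsto 0
            rw [zero_pow hm.ne'] at this
            exact this.mono_left nhdsWithin_le_nhds
          have ht' : Tendsto (fun e => P (u, e)) (𝓝[≠] 0) (𝓝 (P (u, 0))) :=
            ((hP.continuous.comp (by fun_prop : Continuous fun e : ℝ => (u, e))).tendsto 0).mono_left nhdsWithin_le_nhds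
          exact tendsto_nhds_unique ht' ht
        apply Asymptotics.IsBigO.of_bound c
        rw [eventually_nhdsWithin_iff] at hc
        filter_upwards [hc] with e he
        by_cases h : e = 0
        · subst h; simp [hz, hm.ne']
        · exact he h)
    refine ⟨N, hN, fun u e => ?_⟩
    rw [hGP, hPN, smul_smul, pow_succ']
theorem exists_perm_of_count {m : ℕ} {α : Type} [DecidableEq α] (r r' : Fin m → α)
    (h : ∀ j, (Finset.univ.filter fun i => r i = j).card = (Finset.univ.filter fun i => r' i = j).card) :
    ∃ σ : Equiv.Perm (Fin m), r' = r ∘ σ := by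
  have h' : ∀ j, Nonempty ({i // r' i = j} ≃ {i // r i = j}) := by
    intro j
    rw [← Fintype.card_eq, Fintype.card_subtype, Fintype.card_subtype, h]
  have e := fun j => (h' j).some
  refine ⟨(Equiv.sigmaFiberEquiv r').symm.trans ((Equiv.sigmaCongrRight e).trans (Equiv.sigmaFiberEquiv r)), ?_⟩
  ext1 i
  simp only [Function.comp, Equiv.trans_apply]
  exact ((e (r' i)) ⟨i, rfl⟩).2.symm

theorem card_fiber {m J : ℕ} (b : Fin J → ℕ) (hb : ∑ j, b j = m) :
    (Finset.univ.filter fun r : Fin m → Fin J => ∀ j, (Finset.univ.filter fun i => r i = j).card = b j).card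
      * ∏ j, (b j).factorial = m.factorial := by
  have h1 := Finset.sum_pow' (R := MvPolynomial (Fin J) ℕ) (Finset.univ : Finset (Fin J)) (fun j => MvPolynomial.X j) m
  have h2 := Finset.sum_pow_eq_sum_piAntidiag (R := MvPolynomial (Fin J) ℕ) (Finset.univ : Finset (Fin J)) (fun j => MvPolynomial.X j) m
  rw [h1] at h2
  have h3 : ∀ r : Fin m → Fin J, ∏ i, (MvPolynomial.X (r i) : MvPolynomial (Fin J) ℕ) = 
      ∏ j, MvPolynomial.X j ^ (Finset.univ.filter fun i => r i = j).card := by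
    intro r
    rw [← Finset.prod_fiberwise Finset.univ r]
    refine Finset.prod_congr rfl fun j _ => ?_
    rw [← Finset.prod_const]
    refine Finset.prod_congr rfl fun i hi => ?_
    rw [(Finset.mem_filter.1 hi).2]
  have h4 := congrArg (MvPolynomial.coeff (Finsupp.equivFunOnFinite.symm b)) h2
  simp only [Fintype.piFinset_univ, h3, MvPolynomial.coeff_sum] at h4
  have h5 : ∀ k : Fin J → ℕ, MvPolynomial.coeff (Finsupp.equivFunOnFinite.symm b) (∏ j, (MvPolynomial.X j : MvPolynomial (Fin J) ℕ) ^ k j) = if k = b then 1 else 0 := by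
    intro k
    rw [MvPolynomial.coeff_prod_X_pow]
    congr 1
    rw [eq_iff_iff]
    constructor
    · intro h; ext j; simpa using (DFunLike.congr_fun h j).symm
    · rintro rfl; ext j; simp
  have h6 : ∀ k : Fin J → ℕ, MvPolynomial.coeff (Finsupp.equivFunOnFinite.symm b) ((Nat.multinomial Finset.univ k : MvPolynomial (Fin J) ℕ) * ∏ j, (MvPolynomial.X j : MvPolynomial (Fin J) ℕ) ^ k j) = if k = b then Nat.multinomial Finset.univ k else 0 := by
    intro k
    rw [← map_natCast (MvPolynomial.C), MvPolynomial.coeff_C_mul, h5]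
    simp
  simp only [h5, h6] at h4
  rw [Finset.sum_ite_eq_of_mem' _ _ _ (by simp [hb]), ← Finset.sum_filter, Finset.sum_const, smul_eq_mul, mul_one] at h4
  have hs := Nat.multinomial_spec Finset.univ b
  rw [hb] at hs
  rw [← hs, mul_comm, ← h4]
  congr 1
  congr 1
  ext r
  simp [funext_iff]

def idxList (p m : ℕ) (b : Fin (p - m + 1) → Fin (p + 1)) : List (Fin (p - m + 1)) :=
  (List.finRange (p - m + 1)).flatMap fun j => List.replicate (b j : ℕ) j

theorem bellArgs_eq {E : Type} (p m : ℕ) (b : Fin (p - m + 1) → Fin (p + 1)) (v : ℕ → E) :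
    bellArgs p m b v = (idxList p m b).map fun j : Fin (p - m + 1) => v ((j : ℕ) + 1) := by
  simp only [bellArgs, idxList, List.map_flatMap, List.map_replicate]

theorem idxList_length (p m : ℕ) (b : Fin (p - m + 1) → Fin (p + 1)) :
    (idxList p m b).length = ∑ j, (b j : ℕ) := by
  simp [idxList, List.length_flatMap, Fin.sum_univ_def]

theorem idxList_count (p m : ℕ) (b : Fin (p - m + 1) → Fin (p + 1)) (j) :
    (idxList p m b).count j = (b j : ℕ) := by
  simp only [idxList, List.count_flatMap]
  have : ∑ i, (if i = j then (b i : ℕ) else 0) = (b j : ℕ) := by simp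
  rw [← this, Fin.sum_univ_def]
  congr 2
  ext i
  simp [List.count_replicate]

theorem count_get {α : Type} [DecidableEq α] {m : ℕ} (l : List α) (h : l.length = m) (a : α) : 
    (Finset.univ.filter fun i : Fin m => l.get (i.cast h.symm) = a).card = l.count a := by
  subst h
  have h1 : (Finset.univ.val.map fun i : Fin l.length => l.get i) = (l : Multiset α) := by
    rw [Fin.univ_val_map]; simp
  rw [← Multiset.coe_count, ← h1, Multiset.count_map, Finset.card_def, Finset.filter_val]
  simp only [Fin.cast_eq_self, eq_comm]

theorem bell_key {E : Type} [NormedAddCommGroup E] [NormedSpace ℝ E] (p m : ℕ) (hmp : m ≤ p)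
    (D : ContinuousMultilinearMap ℝ (fun _ : Fin m => E) E) 
    (hD : ∀ (v : Fin m → E) (σ : Equiv.Perm (Fin m)), D (v ∘ σ) = D v) (v : ℕ → E) :
    ∑ r ∈ Finset.univ.filter (fun r : Fin m → Fin (p - m + 1) => ∑ i, ((r i : ℕ) + 1) = p), 
      (∏ i, (((r i : ℕ) + 1).factorial : ℝ)⁻¹) • D (fun i => v ((r i : ℕ) + 1)) 
    = ((m.factorial : ℝ) / p.factorial) • bellApplyD p m D v := by
  have hle : ∀ (r : Fin m → Fin (p - m + 1)) j, (Finset.univ.filter fun i => r i = j).card < p + 1 := by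
    intro r j
    have := Finset.card_filter_le (Finset.univ : Finset (Fin m)) (fun i => r i = j)
    simp at this
    omega
  let B : (Fin m → Fin (p - m + 1)) → Fin (p - m + 1) → Fin (p + 1) := fun r j => ⟨_, hle r j⟩
  have hB1 : ∀ r, ∑ j, ((B r j : Fin (p+1)) : ℕ) = m := by
    intro r
    have := Finset.card_eq_sum_card_fiberwise (f := r) (s := Finset.univ) (t := Finset.univ) (by intro; simp)
    simpa using this.symm
  have hB2 : ∀ r, ∑ j : Fin (p - m + 1), ((j : ℕ) + 1) * ((B r j : Fin (p+1)) : ℕ) = ∑ i, ((r i : ℕ) + 1) := by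
    intro r
    rw [← Finset.sum_fiberwise Finset.univ r]
    refine Finset.sum_congr rfl fun j _ => ?_
    rw [Finset.sum_congr rfl (g := fun _ => (j : ℕ) + 1), Finset.sum_const, smul_eq_mul, mul_comm]
    intro i hi
    rw [(Finset.mem_filter.1 hi).2]
  have hB3 : ∀ r, ∏ i, (((r i : ℕ) + 1).factorial : ℝ)⁻¹ = (∏ j : Fin (p - m + 1), ((((j : ℕ) + 1).factorial : ℝ)) ^ ((B r j : Fin (p+1)) : ℕ))⁻¹ := by
    intro r
    rw [← Finset.prod_fiberwise Finset.univ r, ← Finset.prod_inv_distrib]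
    refine Finset.prod_congr rfl fun j _ => ?_
    rw [Finset.prod_congr rfl (g := fun _ => (((j : ℕ) + 1).factorial : ℝ)⁻¹), Finset.prod_const, inv_pow]
    intro i hi
    rw [(Finset.mem_filter.1 hi).2]
  rw [← Finset.sum_fiberwise_of_maps_to (g := B) (t := bellIdx p m)]
  swap
  · intro r hr
    simp only [bellIdx, Finset.mem_filter, Finset.mem_univ, true_and] at hr ⊢
    exact ⟨(hB2 r).trans hr, hB1 r⟩
  rw [bellApplyD, Finset.smul_sum]
  refine Finset.sum_congr rfl fun b hb => ?_
  simp only [bellIdx, Finset.mem_filter, Finset.mem_univ, true_and] at hb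
  have hset : (Finset.univ.filter (fun r : Fin m → Fin (p - m + 1) => ∑ i, ((r i : ℕ) + 1) = p)).filter (fun r => B r = b) =
     Finset.univ.filter fun r : Fin m → Fin (p - m + 1) => ∀ j, (Finset.univ.filter fun i => r i = j).card = (b j : ℕ) := by
    ext r
    simp only [Finset.mem_filter, Finset.mem_univ, true_and]
    constructor
    · rintro ⟨-, rfl⟩ j; rfl
    · intro h
      have : B r = b := by ext j; exact h j
      exact ⟨by rw [← hB2, this, hb.1], this⟩
  have hconst : ∀ r ∈ (Finset.univ.filter (fun r : Fin m → Fin (p - m + 1) => ∑ i, ((r i : ℕ) + 1) = p)).filter (fun r => B r = b),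
      (∏ i, (((r i : ℕ) + 1).factorial : ℝ)⁻¹) • D (fun i => v ((r i : ℕ) + 1)) 
       = (∏ j : Fin (p - m + 1), ((((j : ℕ) + 1).factorial : ℝ)) ^ (b j : ℕ))⁻¹ • D fun i => (bellArgs p m b v).getD (i : ℕ) 0 := by
    intro r hr
    obtain rfl := (Finset.mem_filter.1 hr).2
    rw [hB3]
    congr 1
    have hlen : (idxList p m (B r)).length = m := by rw [idxList_length, hB1]
    obtain ⟨σ, hσ⟩ := exists_perm_of_count r (fun i : Fin m => (idxList p m (B r)).get (i.cast hlen.symm)) (by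
      intro j
      rw [count_get _ hlen, idxList_count])
    rw [← hD _ σ]
    congr 1
    ext1 i
    rw [bellArgs_eq, List.getD_eq_getElem _ _ (by simp [hlen])]
    have := congrFun hσ i
    simp only [Function.comp, List.get_eq_getElem, Fin.val_cast] at this
    rw [List.getElem_map, this]
    rfl
  rw [Finset.sum_congr rfl hconst, Finset.sum_const, hset]
  have hc := card_fiber (fun j => (b j : ℕ)) hb.2
  rw [← Nat.cast_smul_eq_nsmul ℝ, smul_smul, smul_smul]
  congr 1
  rw [← hc, bellCoeff]
  have h1 : (p.factorial : ℝ) ≠ 0 := by positivity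
  have h2 : (∏ j : Fin (p - m + 1), ((b j : ℕ).factorial : ℝ)) ≠ 0 := by positivity
  push_cast
  field_simp

theorem bell_key' {E : Type} [NormedAddCommGroup E] [NormedSpace ℝ E] (p m N : ℕ) (hm : 1 ≤ m) (hmp : m ≤ p) (hpN : p ≤ N)
    (D : ContinuousMultilinearMap ℝ (fun _ : Fin m => E) E) 
    (hD : ∀ (v : Fin m → E) (σ : Equiv.Perm (Fin m)), D (v ∘ σ) = D v) (v : ℕ → E) :
    ∑ r ∈ (Fintype.piFinset (fun _ : Fin m => Finset.Icc 1 N)).filter (fun r => ∑ i, r i = p), 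
      (∏ i, ((r i).factorial : ℝ)⁻¹) • D (fun i => v (r i)) 
    = ((m.factorial : ℝ) / p.factorial) • bellApplyD p m D v := by
  rw [← bell_key p m hmp D hD v]
  symm
  refine Finset.sum_bij (fun r _ i => (r i : ℕ) + 1) ?_ ?_ ?_ ?_
  · intro r hr
    simp only [Finset.mem_filter, Finset.mem_univ, true_and, Fintype.mem_piFinset, Finset.mem_Icc] at hr ⊢
    refine ⟨fun i => ⟨by omega, ?_⟩, hr⟩
    have := (r i).2
    omega
  · intro r _ r' _ h
    ext i
    simpa using congrFun h i
  · intro r hr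
    simp only [Finset.mem_filter, Finset.mem_univ, true_and, Fintype.mem_piFinset, Finset.mem_Icc] at hr ⊢
    have hlt : ∀ i, r i - 1 < p - m + 1 := by
      intro i
      have h1 : ∑ j ∈ Finset.univ.erase i, 1 ≤ ∑ j ∈ Finset.univ.erase i, r j := Finset.sum_le_sum fun j _ => (hr.1 j).1
      have h2 := Finset.add_sum_erase Finset.univ r (Finset.mem_univ i)
      rw [hr.2] at h2
      simp [Finset.card_erase_of_mem] at h1
      omega
    have hs : ∀ i, r i - 1 + 1 = r i := fun i => Nat.sub_add_cancel (hr.1 i).1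
    refine ⟨fun i => ⟨r i - 1, hlt i⟩, by simp [hs, hr.2], by simp [hs]⟩
  · intro r hr
    rfl
open Asymptotics in
theorem taylor_bigO {E : Type} [NormedAddCommGroup E] [NormedSpace ℝ E] [ProperSpace E] 
   {F : Type} [NormedAddCommGroup F] [NormedSpace ℝ F] [CompleteSpace F] (f : E → F) 
   (hf : ContDiff ℝ (⊤ : ℕ∞) f) (z : E) (h : ℝ → E) (hO : h =O[𝓝 0] fun e : ℝ => e) (N : ℕ) :
   (fun e => f (z + h e) - ∑ m ∈ Finset.range (N + 1), ((m.factorial : ℝ))⁻¹ • iteratedFDeriv ℝ m f z (fun _ => h e))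
     =O[𝓝 0] fun e : ℝ => e ^ (N + 1) := by
  have hcont : Continuous (iteratedFDeriv ℝ (N+1) f) :=
    hf.continuous_iteratedFDeriv (by exact_mod_cast (le_top : ((N + 1 : ℕ) : ℕ∞) ≤ ⊤))
  obtain ⟨C, hC⟩ := (isCompact_closedBall z 1).exists_bound_of_continuousOn hcont.continuousOn
  have hsmall : ∀ᶠ e in 𝓝 (0:ℝ), ‖h e‖ ≤ 1 := by
    have : Tendsto h (𝓝 0) (𝓝 0) := hO.trans_tendsto tendsto_id
    filter_upwards [this.eventually (Metric.closedBall_mem_nhds 0 one_pos)] with e he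
    simpa using he
  have h1 : (fun e => f (z + h e) - ∑ m ∈ Finset.range (N + 1), ((m.factorial : ℝ))⁻¹ • iteratedFDeriv ℝ m f z (fun _ => h e))
     =O[𝓝 0] fun e : ℝ => ‖h e‖ ^ (N + 1) := by
    apply IsBigO.of_bound (((N.factorial : ℝ))⁻¹ * C)
    filter_upwards [hsmall] with e he
    rw [map_add_eq_sum_add_integral_iteratedFDeriv (n := N) (fun t _ => hf.contDiffAt.of_le (by exact_mod_cast (le_top : ((N + 1 : ℕ) : ℕ∞) ≤ ⊤))), add_sub_cancel_left, norm_smul, mul_assoc]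
    rw [norm_inv, Real.norm_natCast]
    gcongr
    have := intervalIntegral.norm_integral_le_of_norm_le_const (a := 0) (b := 1) (f := fun t : ℝ => (1 - t) ^ N • iteratedFDeriv ℝ (N + 1) f (z + t • h e) (fun _ ↦ h e)) (C := C * ‖h e‖ ^ (N+1)) ?_
    · simpa using this
    · intro t ht
      rw [uIoc_of_le zero_le_one] at ht
      rw [norm_smul]
      have h2 : ‖(1 - t) ^ N‖ ≤ 1 := by
        rw [norm_pow, Real.norm_eq_abs]
        apply pow_le_one₀ (abs_nonneg _)
        rw [abs_le]; constructor <;> linarith [ht.1, ht.2]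
      have h3 : ‖iteratedFDeriv ℝ (N + 1) f (z + t • h e) (fun _ ↦ h e)‖ ≤ C * ‖h e‖ ^ (N+1) := by
        refine (ContinuousMultilinearMap.le_opNorm _ _).trans ?_
        simp only [Finset.prod_const, Finset.card_univ, Fintype.card_fin]
        gcongr
        apply hC
        simp only [Metric.mem_closedBall, dist_self_add_left, norm_smul, Real.norm_eq_abs, abs_of_pos ht.1]
        nlinarith [ht.1, ht.2, norm_nonneg (h e)]
      calc _ ≤ 1 * (C * ‖h e‖ ^ (N+1)) := by gcongr
        _ = _ := one_mul _
  exact h1.trans (hO.norm_left.pow _)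

def hpoly {E : Type} [NormedAddCommGroup E] [NormedSpace ℝ E] (L : ℕ) (v : ℕ → E) (e : ℝ) : E :=
  ∑ j ∈ Finset.Icc 1 L, (e ^ j * ((j.factorial : ℝ))⁻¹) • v j

open Asymptotics in
theorem pow_bigO {a b : ℕ} (h : b ≤ a) : (fun e : ℝ => e ^ a) =O[𝓝 0] fun e : ℝ => e ^ b := by
  apply IsBigO.of_bound 1
  filter_upwards [Metric.closedBall_mem_nhds (0:ℝ) one_pos] with e he
  rw [one_mul, norm_pow, norm_pow]
  exact pow_le_pow_of_le_one (norm_nonneg _) (by simpa using he) h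

open Asymptotics in
theorem hpoly_bigO {E : Type} [NormedAddCommGroup E] [NormedSpace ℝ E] (L : ℕ) (v : ℕ → E) :
    hpoly L v =O[𝓝 0] fun e : ℝ => e := by
  unfold hpoly
  apply IsBigO.fun_sum
  intro j hj
  have h1 : (fun e : ℝ => e ^ j) =O[𝓝 0] fun e : ℝ => e := by
    simpa using pow_bigO (Finset.mem_Icc.1 hj).1
  have h2 := (h1.mul (isBigO_const_const (((j.factorial : ℝ))⁻¹) (one_ne_zero (α := ℝ)) (𝓝 0))).smul (isBigO_const_const (v j) (one_ne_zero (α := ℝ)) (𝓝 0))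
  simpa using h2

open Asymptotics in
theorem pow_smul_bigO {E : Type} [NormedAddCommGroup E] [NormedSpace ℝ E] {a b : ℕ} (h : b ≤ a) (v : E) : (fun e : ℝ => e ^ a • v) =O[𝓝 0] fun e : ℝ => e ^ b := by
  simpa using (pow_bigO h).smul (isBigO_const_const v (one_ne_zero (α := ℝ)) (𝓝 0))

open Asymptotics in
theorem multilin_expand {E : Type} [NormedAddCommGroup E] [NormedSpace ℝ E] (m N L : ℕ) (hm : 1 ≤ m) (hNL : N ≤ L)
    (D : ContinuousMultilinearMap ℝ (fun _ : Fin m => E) E) 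
    (hD : ∀ (v : Fin m → E) (σ : Equiv.Perm (Fin m)), D (v ∘ σ) = D v) (v : ℕ → E) :
    (fun e : ℝ => ((m.factorial : ℝ))⁻¹ • D (fun _ => hpoly L v e) - 
      ∑ p ∈ Finset.Icc m N, (e ^ p * ((p.factorial : ℝ))⁻¹) • bellApplyD p m D v) =O[𝓝 0] fun e : ℝ => e ^ (N + 1) := by
  have h1 : ∀ e : ℝ, D (fun _ => hpoly L v e) = ∑ r ∈ Fintype.piFinset (fun _ : Fin m => Finset.Icc 1 L), 
      e ^ (∑ i, r i) • (∏ i, ((r i).factorial : ℝ)⁻¹) • D (fun i => v (r i)) := by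
    intro e
    unfold hpoly
    refine (D.toMultilinearMap.map_sum_finset (fun (_ : Fin m) j => (e ^ j * ((j.factorial : ℝ))⁻¹) • v j) (fun _ => Finset.Icc 1 L)).trans ?_
    refine Finset.sum_congr rfl fun r _ => ?_
    rw [MultilinearMap.map_smul_univ, Finset.prod_mul_distrib, Finset.prod_pow_eq_pow_sum, mul_smul]
    rfl
  have h2 : ∀ e : ℝ, ((m.factorial : ℝ))⁻¹ • D (fun _ => hpoly L v e) - 
      ∑ p ∈ Finset.Icc m N, (e ^ p * ((p.factorial : ℝ))⁻¹) • bellApplyD p m D v = 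
      ((m.factorial : ℝ))⁻¹ • ∑ r ∈ (Fintype.piFinset (fun _ : Fin m => Finset.Icc 1 L)).filter (fun r => ¬ ∑ i, r i ≤ N), 
      e ^ (∑ i, r i) • (∏ i, ((r i).factorial : ℝ)⁻¹) • D (fun i => v (r i)) := by
    intro e
    rw [h1, ← Finset.sum_filter_add_sum_filter_not _ (fun r => ∑ i, r i ≤ N), smul_add, add_sub_right_comm]
    convert zero_add _
    rw [sub_eq_zero, ← Finset.sum_fiberwise_of_maps_to (g := fun r => ∑ i, r i) (t := Finset.Icc m N), Finset.smul_sum]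
    · refine Finset.sum_congr rfl fun p hp => ?_
      rw [Finset.mem_Icc] at hp
      have hf : ((Fintype.piFinset (fun _ : Fin m => Finset.Icc 1 L)).filter (fun r => ∑ i, r i ≤ N)).filter (fun r => ∑ i, r i = p)
        = (Fintype.piFinset (fun _ : Fin m => Finset.Icc 1 L)).filter (fun r => ∑ i, r i = p) := by
        rw [Finset.filter_filter]
        apply Finset.filter_congr
        intro r _
        omega
      rw [hf]
      have hk := bell_key' p m L hm hp.1 (hp.2.trans hNL) D hD v
      rw [Finset.sum_congr rfl (g := fun r => e ^ p • (∏ i, ((r i).factorial : ℝ)⁻¹) • D (fun i => v (r i)))]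
      · rw [← Finset.smul_sum, hk, smul_smul, smul_smul]
        congr 1
        have : (m.factorial : ℝ) ≠ 0 := by positivity
        field_simp
      · intro r hr
        rw [(Finset.mem_filter.1 hr).2]
    · intro r hr
      simp only [Finset.mem_filter, Fintype.mem_piFinset, Finset.mem_Icc] at hr ⊢
      refine ⟨?_, hr.2⟩
      have : ∑ i : Fin m, 1 ≤ ∑ i, r i := Finset.sum_le_sum fun i _ => (hr.1 i).1
      simpa using this
  simp only [h2]
  apply IsBigO.const_smul_left
  apply IsBigO.fun_sum
  intro r hr
  apply pow_smul_bigO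
  have := (Finset.mem_filter.1 hr).2
  omega

open Asymptotics in
theorem bell_expand {E : Type} [NormedAddCommGroup E] [NormedSpace ℝ E] [ProperSpace E] (f : E → E) 
   (hf : ContDiff ℝ (⊤ : ℕ∞) f) (z : E) (N L : ℕ) (hNL : N ≤ L) (v : ℕ → E) :
   (fun e => f (z + hpoly L v e) - (f z + ∑ p ∈ Finset.Icc 1 N, (e ^ p * ((p.factorial : ℝ))⁻¹) • 
      ∑ m ∈ Finset.Icc 1 p, bellApplyD p m (iteratedFDeriv ℝ m f z) v)) =O[𝓝 0] fun e : ℝ => e ^ (N + 1) := by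
  have h1 := taylor_bigO f hf z (hpoly L v) (hpoly_bigO L v) N
  have h2 : (fun e : ℝ => ∑ m ∈ Finset.Icc 1 N, (((m.factorial : ℝ))⁻¹ • iteratedFDeriv ℝ m f z (fun _ => hpoly L v e) - 
      ∑ p ∈ Finset.Icc m N, (e ^ p * ((p.factorial : ℝ))⁻¹) • bellApplyD p m (iteratedFDeriv ℝ m f z) v)) =O[𝓝 0] fun e : ℝ => e ^ (N + 1) := by
    apply IsBigO.fun_sum
    intro m hm
    exact multilin_expand m N L (Finset.mem_Icc.1 hm).1 hNL _ (fun w σ => symm_swap m f hf z w σ) v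
  refine (h1.add h2).congr_left fun e => ?_
  have h3 : Finset.range (N + 1) = insert 0 (Finset.Icc 1 N) := by
    ext i; simp; omega
  rw [h3, Finset.sum_insert (by simp), Finset.sum_sub_distrib]
  simp only [Finset.smul_sum]
  rw [Finset.sum_comm' (s := Finset.Icc 1 N) (t := fun m => Finset.Icc m N) (t' := Finset.Icc 1 N) (s' := fun p => Finset.Icc 1 p)]
  · simp
    abel
  · intro x y; simp only [Finset.mem_Icc]; omega
section ysec
variable {E : Type} [NormedAddCommGroup E] [NormedSpace ℝ E]

theorem cl1 (m : ℕ) : ContDiff ℝ (⊤ : ℕ∞) (fun D : ContinuousMultilinearMap ℝ (fun _ : Fin (m+1) => E) E => continuousMultilinearCurryLeftEquiv ℝ (fun _ : Fin (m+1) => E) E D) := by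
  apply LinearIsometryEquiv.contDiff

theorem cl2 (m : ℕ) : ContDiff ℝ (⊤ : ℕ∞) (fun D : E →L[ℝ] ContinuousMultilinearMap ℝ (fun _ : Fin m => E) E => (continuousMultilinearCurryLeftEquiv ℝ (fun _ : Fin (m+1) => E) E).symm D) := by
  apply LinearIsometryEquiv.contDiff

theorem contDiff_multilin_apply {H : Type} [NormedAddCommGroup H] [NormedSpace ℝ H] (m : ℕ) :
    ∀ (D : H → ContinuousMultilinearMap ℝ (fun _ : Fin m => E) E) (_ : ContDiff ℝ (⊤ : ℕ∞) D)
    (v : Fin m → H → E) (_ : ∀ i, ContDiff ℝ (⊤ : ℕ∞) (v i)),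
    ContDiff ℝ (⊤ : ℕ∞) fun w => D w (fun i => v i w) := by
  induction m with
  | zero =>
    intro D hD v hv
    have : (fun w => D w (fun i => v i w)) = fun w => continuousMultilinearCurryFin0 ℝ E E (D w) := by
      ext1 w
      rw [continuousMultilinearCurryFin0_apply]
      congr 1; ext1 i; exact i.elim0
    rw [this]
    exact (continuousMultilinearCurryFin0 ℝ E E).contDiff.comp hD
  | succ m ih =>
    intro D hD v hv
    have := ih (fun w => continuousMultilinearCurryLeftEquiv ℝ (fun _ : Fin (m+1) => E) E (D w) (v 0 w))
      (ContDiff.clm_apply ((cl1 m).comp hD) (hv 0)) (fun i => v i.succ) (fun i => hv _)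
    convert this using 2 with w
    rw [continuousMultilinearCurryLeftEquiv_apply]
    congr 1
    ext1 i
    refine Fin.cases ?_ (fun j => ?_) i <;> simp

theorem contDiff_iteratedFDeriv_param {f : ℝ → E → E} (hf : ContDiff ℝ (⊤ : ℕ∞) fun w : ℝ × E => f w.1 w.2) (m : ℕ) :
    ContDiff ℝ (⊤ : ℕ∞) fun w : ℝ × E => iteratedFDeriv ℝ m (f w.1) w.2 := by
  induction m with
  | zero =>
    simp only [iteratedFDeriv_zero_eq_comp]
    exact (continuousMultilinearCurryFin0 ℝ E E).symm.contDiff.comp hf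
  | succ m ih =>
    simp only [iteratedFDeriv_succ_eq_comp_left]
    refine (cl2 m).comp ?_
    apply ContDiff.fderiv (m := (⊤:ℕ∞)) (n := (⊤:ℕ∞)) (f := fun (w : ℝ × E) u => iteratedFDeriv ℝ m (f w.1) u) (g := fun w : ℝ × E => w.2)
    · exact ih.comp (by fun_prop : ContDiff ℝ (⊤:ℕ∞) fun q : (ℝ × E) × E => (q.1.1, q.2))
    · fun_prop
    · simp

theorem bellApplyD_congr (p m : ℕ) (D : ContinuousMultilinearMap ℝ (fun _ : Fin m => E) E) (v v' : ℕ → E)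
    (h : ∀ j, j ≤ p - m + 1 → v j = v' j) : bellApplyD p m D v = bellApplyD p m D v' := by
  unfold bellApplyD
  refine Finset.sum_congr rfl fun b _ => ?_
  rw [bellArgs_eq, bellArgs_eq]
  have : (fun j : Fin (p - m + 1) => v ((j : ℕ) + 1)) = fun j : Fin (p - m + 1) => v' ((j : ℕ) + 1) := by
    ext1 j; exact h _ (by omega)
  rw [this]

theorem contDiff_bellApplyD {H : Type} [NormedAddCommGroup H] [NormedSpace ℝ H] (p m : ℕ)
    (D : H → ContinuousMultilinearMap ℝ (fun _ : Fin m => E) E) (hD : ContDiff ℝ (⊤ : ℕ∞) D)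
    (v : H → ℕ → E) (hv : ∀ j, j ≤ p - m + 1 → ContDiff ℝ (⊤ : ℕ∞) (fun w => v w j)) : 
    ContDiff ℝ (⊤ : ℕ∞) fun w => bellApplyD p m (D w) (v w) := by
  unfold bellApplyD
  refine ContDiff.sum fun b _ => contDiff_const.smul ?_
  apply contDiff_multilin_apply m D hD
  intro i
  simp only [bellArgs_eq]
  by_cases h : (i : ℕ) < (idxList p m b).length
  · have : ∀ w, ((idxList p m b).map fun j : Fin (p - m + 1) => v w ((j : ℕ) + 1)).getD (i : ℕ) 0 = v w (((idxList p m b)[(i : ℕ)] : ℕ) + 1) := by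
      intro w
      rw [List.getD_eq_getElem _ _ (by simpa using h), List.getElem_map]
    simp only [this]
    exact hv _ (by have := ((idxList p m b)[(i : ℕ)]).2; omega)
  · have : ∀ w, ((idxList p m b).map fun j : Fin (p - m + 1) => v w ((j : ℕ) + 1)).getD (i : ℕ) 0 = 0 := by
      intro w
      rw [List.getD_eq_default _ _ (by simpa using h)]
    simp only [this]
    exact contDiff_const

variable (F : ℕ → ℝ → E → E)

theorem ySeq_stable (l j : ℕ) (h : j ≤ l) : ySeq F l j = ySeq F j j := by
  induction l with
  | zero => obtain rfl : j = 0 := by omega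
            rfl
  | succ l ih =>
    rcases Nat.lt_or_ge l j with h1 | h1
    · obtain rfl : j = l + 1 := by omega
      rfl
    · rw [← ih h1]
      ext1 t; ext1 x
      rw [ySeq]
      exact if_pos h1

/-- the integrand -/
def yI (l j : ℕ) (s : ℝ) (x : E) : E :=
  (j.factorial : ℝ) • F j s x + ∑ p ∈ Finset.Icc 1 (j - 1), ∑ m ∈ Finset.Icc 1 p,
    ((j.factorial : ℝ) / (p.factorial : ℝ)) • bellApplyD p m (iteratedFDeriv ℝ m (F (j - p) s) x)
      (fun j' => ySeq F l j' s x)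

theorem yI_eq (l j i : ℕ) (hj : j ≤ l) (hi : j ≤ i + 1) (hj1 : 1 ≤ j) (s : ℝ) (x : E) : yI F l j s x = yI F i j s x := by
  unfold yI
  congr 1
  refine Finset.sum_congr rfl fun p hp => Finset.sum_congr rfl fun m hm => ?_
  rw [Finset.mem_Icc] at hp hm
  congr 1
  apply bellApplyD_congr
  intro j' hj'
  rw [ySeq_stable F l j' (by omega), ySeq_stable F i j' (by omega)]

theorem ySeq_eq (l j : ℕ) (hj1 : 1 ≤ j) (hj : j ≤ l) (t : ℝ) (x : E) :
    ySeq F l j t x = ∫ s in (0:ℝ)..t, yI F l j s x := by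
  rw [ySeq_stable F l j hj]
  obtain ⟨i, rfl⟩ : ∃ i, j = i + 1 := ⟨j - 1, by omega⟩
  simp only [yI_eq F l (i + 1) i hj le_rfl hj1]
  rw [ySeq]
  beta_reduce
  rw [if_neg (by omega), if_pos rfl]
  rfl

theorem contDiff_yI (k i j : ℕ) (hF : ∀ i ∈ Finset.Icc 1 k, ContDiff ℝ (⊤ : ℕ∞) fun w : ℝ × E => F i w.1 w.2)
    (hj1 : 1 ≤ j) (hj : j ≤ k) (hji : j ≤ i + 1) (hy : ∀ j' ≤ i, ContDiff ℝ (⊤ : ℕ∞) fun w : ℝ × E => ySeq F i j' w.1 w.2) :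
    ContDiff ℝ (⊤ : ℕ∞) fun w : ℝ × E => yI F i j w.1 w.2 := by
  unfold yI
  refine ContDiff.add (contDiff_const.smul (hF j (Finset.mem_Icc.2 ⟨hj1, hj⟩))) ?_
  refine ContDiff.sum fun p hp => ContDiff.sum fun m hm => contDiff_const.smul ?_
  rw [Finset.mem_Icc] at hp hm
  apply contDiff_bellApplyD p m _ (contDiff_iteratedFDeriv_param (hF _ (Finset.mem_Icc.2 ⟨by omega, by omega⟩)) m)
  intro j' hj'
  exact hy j' (by omega)

variable [ProperSpace E] [CompleteSpace E]

theorem contDiff_ySeq (k : ℕ) (hF : ∀ i ∈ Finset.Icc 1 k, ContDiff ℝ (⊤ : ℕ∞) fun w : ℝ × E => F i w.1 w.2) (l : ℕ) (hl : l ≤ k) :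
    ∀ j ≤ l, ContDiff ℝ (⊤ : ℕ∞) fun w : ℝ × E => ySeq F l j w.1 w.2 := by
  induction l with
  | zero => 
    intro j hj
    simp only [ySeq]
    exact contDiff_const
  | succ l ih =>
    intro j hj
    rcases Nat.lt_or_ge l j with h1 | h1
    · obtain rfl : j = l + 1 := by omega
      simp only [ySeq_eq F (l+1) (l+1) (by omega) le_rfl, yI_eq F (l+1) (l + 1) l le_rfl le_rfl (by omega)]
      apply contDiff_primitive (G := fun w : ℝ × E => yI F l (l+1) w.1 w.2)
      exact contDiff_yI F k l (l+1) hF (by omega) hl le_rfl (ih (by omega))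
    · have := ih (by omega) j h1
      rw [ySeq_stable F l j h1] at this
      rwa [ySeq_stable F (l+1) j hj]

end ysec
section keysec
variable {E : Type} [NormedAddCommGroup E] [NormedSpace ℝ E]

/-- right-hand side of the differential equation -/
def rhsF (F : ℕ → ℝ → E → E) (Ft : ℝ → E → ℝ → E) (k : ℕ) (s : ℝ) (x : E) (e : ℝ) : E :=
  (∑ i ∈ Finset.Icc 1 k, e ^ i • F i s x) + e ^ (k + 1) • Ft s x e

theorem hpoly_yI (F : ℕ → ℝ → E → E) (l : ℕ) (s : ℝ) (z : E) (e : ℝ) :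
    hpoly l (fun j => yI F l j s z) e =
      ∑ i ∈ Finset.Icc 1 l, e ^ i • (F i s z + ∑ p ∈ Finset.Icc 1 (l - i), (e ^ p * ((p.factorial : ℝ))⁻¹) •
        ∑ m ∈ Finset.Icc 1 p, bellApplyD p m (iteratedFDeriv ℝ m (F i s) z) (fun j => ySeq F l j s z)) := by
  unfold hpoly
  have h1 : ∀ j ∈ Finset.Icc 1 l, (e ^ j * ((j.factorial : ℝ))⁻¹) • yI F l j s z =
      e ^ j • F j s z + ∑ p ∈ Finset.Icc 1 (j - 1), (e ^ j * ((p.factorial : ℝ))⁻¹) •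
        ∑ m ∈ Finset.Icc 1 p, bellApplyD p m (iteratedFDeriv ℝ m (F (j - p) s) z) (fun j => ySeq F l j s z) := by
    intro j _
    have hj : (j.factorial : ℝ) ≠ 0 := by positivity
    unfold yI
    rw [smul_add, smul_smul, mul_assoc, inv_mul_cancel₀ hj, mul_one]
    congr 1
    rw [Finset.smul_sum]
    refine Finset.sum_congr rfl fun p _ => ?_
    rw [Finset.smul_sum, Finset.smul_sum]
    refine Finset.sum_congr rfl fun m _ => ?_
    rw [smul_smul]
    congr 1
    field_simp
  rw [Finset.sum_congr rfl h1]
  simp only [smul_add, Finset.sum_add_distrib]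
  congr 1
  simp only [Finset.smul_sum (r := e ^ _) (s := Finset.Icc 1 (_ - _))]
  rw [Finset.sum_sigma', Finset.sum_sigma']
  refine Finset.sum_bij' (fun q _ => ⟨q.1 - q.2, q.2⟩) (fun q _ => ⟨q.1 + q.2, q.2⟩) ?_ ?_ ?_ ?_ ?_
  · rintro ⟨j, p⟩ h
    simp only [Finset.mem_sigma, Finset.mem_Icc] at h ⊢
    omega
  · rintro ⟨j, p⟩ h
    simp only [Finset.mem_sigma, Finset.mem_Icc] at h ⊢
    omega
  · rintro ⟨j, p⟩ h
    simp only [Finset.mem_sigma, Finset.mem_Icc] at h ⊢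
    rw [Nat.sub_add_cancel (by omega)]
  · rintro ⟨j, p⟩ h
    simp only [Nat.add_sub_cancel]
  · rintro ⟨j, p⟩ h
    simp only [Finset.mem_sigma, Finset.mem_Icc] at h
    simp only
    rw [smul_smul, ← mul_assoc, ← pow_add, Nat.sub_add_cancel (by omega)]

open Asymptotics in
theorem key_bigO [ProperSpace E] [CompleteSpace E] (F : ℕ → ℝ → E → E) (Ft : ℝ → E → ℝ → E) (k l : ℕ) (hl1 : 1 ≤ l) (hlk : l ≤ k)
    (hF : ∀ i ∈ Finset.Icc 1 k, ContDiff ℝ (⊤ : ℕ∞) fun w : ℝ × E => F i w.1 w.2)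
    (hFt : ContDiff ℝ (⊤ : ℕ∞) fun w : ℝ × E × ℝ => Ft w.1 w.2.1 w.2.2) (s : ℝ) (z w : E) :
    (fun e => rhsF F Ft k s (z + hpoly l (fun j => ySeq F l j s z) e + e ^ l • w) e
      - hpoly l (fun j => yI F l j s z) e) =O[𝓝 0] fun e : ℝ => e ^ (l + 1) := by
  have hFs : ∀ i ∈ Finset.Icc 1 k, ContDiff ℝ (⊤ : ℕ∞) (F i s) := fun i hi =>
    (hF i hi).comp (by fun_prop : ContDiff ℝ (⊤:ℕ∞) fun x : E => (s, x))
  set v : ℕ → E := fun j => ySeq F l j s z with hv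
  have hh0 : Tendsto (fun e => z + hpoly l v e) (𝓝 0) (𝓝 z) := by
    have : Tendsto (hpoly l v) (𝓝 0) (𝓝 0) := (hpoly_bigO l v).trans_tendsto tendsto_id
    simpa using this.const_add z
  have hl0 : Tendsto (fun e : ℝ => e ^ l • w) (𝓝 0) (𝓝 0) := by
    have : Continuous fun e : ℝ => e ^ l • w := by fun_prop
    simpa [show l ≠ 0 by omega] using this.tendsto 0
  have hx0 : Tendsto (fun e => z + hpoly l v e + e ^ l • w) (𝓝 0) (𝓝 z) := by
    simpa using hh0.add hl0
  have hdiff : ∀ i ∈ Finset.Icc 1 k, (fun e => F i s (z + hpoly l v e + e ^ l • w) - F i s (z + hpoly l v e)) =O[𝓝 0] fun e : ℝ => e ^ l := by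
    intro i hi
    have hsd : HasStrictFDerivAt (F i s) (fderiv ℝ (F i s) z) z :=
      (hFs i hi).contDiffAt.hasStrictFDerivAt (by simp)
    have := hsd.isBigO_sub.comp_tendsto (hx0.prodMk_nhds hh0)
    refine this.trans ?_
    simp only [Function.comp_def, add_sub_cancel_left]
    simpa using (isBigO_refl (fun e : ℝ => e ^ l) (𝓝 0)).smul (isBigO_const_const w (one_ne_zero (α := ℝ)) (𝓝 0))
  set P : ℕ → ℝ → E := fun i e => F i s z + ∑ p ∈ Finset.Icc 1 (l - i), (e ^ p * ((p.factorial : ℝ))⁻¹) •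
        ∑ m ∈ Finset.Icc 1 p, bellApplyD p m (iteratedFDeriv ℝ m (F i s) z) v with hP
  have hpol : ∀ e, hpoly l (fun j => yI F l j s z) e = ∑ i ∈ Finset.Icc 1 k, e ^ i • (if i ≤ l then P i e else 0) := by
    intro e
    rw [hpoly_yI]
    have : Finset.Icc 1 l ⊆ Finset.Icc 1 k := Finset.Icc_subset_Icc le_rfl hlk
    rw [← Finset.sum_subset this]
    · refine Finset.sum_congr rfl fun i hi => ?_
      rw [if_pos (Finset.mem_Icc.1 hi).2]
    · intro i h1 h2
      rw [if_neg, smul_zero]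
      simp only [Finset.mem_Icc] at h1 h2
      omega
  have hterm : ∀ i ∈ Finset.Icc 1 k, (fun e => e ^ i • (F i s (z + hpoly l v e + e ^ l • w) - (if i ≤ l then P i e else 0))) =O[𝓝 0] fun e : ℝ => e ^ (l + 1) := by
    intro i hi
    have hi' := Finset.mem_Icc.1 hi
    by_cases hil : i ≤ l
    · simp only [if_pos hil]
      have h1 : (fun e => F i s (z + hpoly l v e + e ^ l • w) - P i e) =O[𝓝 0] fun e : ℝ => e ^ (l - i + 1) := by
        have h2 := bell_expand (F i s) (hFs i hi) z (l - i) l (by omega) v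
        have h3 := ((hdiff i hi).trans (pow_bigO (show l - i + 1 ≤ l by omega))).add h2
        refine h3.congr_left fun e => ?_
        simp only [hP]
        abel
      have h4 := (isBigO_refl (fun e : ℝ => e ^ i) (𝓝 0)).smul h1
      refine h4.congr_right fun e => ?_
      rw [smul_eq_mul, ← pow_add]
      congr 1; omega
    · simp only [if_neg hil, sub_zero]
      have h1 : (fun e => F i s (z + hpoly l v e + e ^ l • w)) =O[𝓝 0] fun _ : ℝ => (1 : ℝ) :=
        (((hFs i hi).continuous.tendsto z).comp hx0).isBigO_one ℝ
      simpa using (pow_bigO (show l + 1 ≤ i by omega)).smul h1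
  have hft : (fun e => e ^ (k + 1) • Ft s (z + hpoly l v e + e ^ l • w) e) =O[𝓝 0] fun e : ℝ => e ^ (l + 1) := by
    have h1 : (fun e => Ft s (z + hpoly l v e + e ^ l • w) e) =O[𝓝 0] fun _ : ℝ => (1 : ℝ) := by
      have := (hFt.continuous.tendsto (s, z, 0)).comp (tendsto_const_nhds.prodMk_nhds (hx0.prodMk_nhds tendsto_id))
      exact this.isBigO_one ℝ
    simpa using (pow_bigO (show l + 1 ≤ k + 1 by omega)).smul h1
  refine ((IsBigO.fun_sum hterm).add hft).congr_left fun e => ?_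
  rw [hpol]
  unfold rhsF
  simp only [smul_sub, Finset.sum_sub_distrib]
  abel

end keysec
section fixsec
variable {E : Type} [NormedAddCommGroup E] [NormedSpace ℝ E] [ProperSpace E] [CompleteSpace E]

theorem exists_remainder (F : ℕ → ℝ → E → E) (Ft : ℝ → E → ℝ → E) (k l : ℕ) (hl1 : 1 ≤ l) (hlk : l ≤ k)
    (hF : ∀ i ∈ Finset.Icc 1 k, ContDiff ℝ (⊤ : ℕ∞) fun w : ℝ × E => F i w.1 w.2)
    (hFt : ContDiff ℝ (⊤ : ℕ∞) fun w : ℝ × E × ℝ => Ft w.1 w.2.1 w.2.2) :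
    ∃ N : (ℝ × E × E) × ℝ → E, ContDiff ℝ (⊤ : ℕ∞) N ∧ ∀ s z w e,
      rhsF F Ft k s (z + hpoly l (fun j => ySeq F l j s z) e + e ^ l • w) e
        - hpoly l (fun j => yI F l j s z) e = e ^ (l + 1) • N ((s, z, w), e) := by
  have hy := contDiff_ySeq F k hF l hlk
  have hsz : ContDiff ℝ (⊤ : ℕ∞) fun q : (ℝ × E × E) × ℝ => (q.1.1, q.1.2.1) := by fun_prop
  have hX : ContDiff ℝ (⊤ : ℕ∞) fun q : (ℝ × E × E) × ℝ =>
      q.1.2.1 + hpoly l (fun j => ySeq F l j q.1.1 q.1.2.1) q.2 + q.2 ^ l • q.1.2.2 := by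
    refine ContDiff.add (ContDiff.add (by fun_prop) ?_) (by fun_prop)
    unfold hpoly
    refine ContDiff.sum fun j hj => ContDiff.smul (by fun_prop) ?_
    exact (hy j (Finset.mem_Icc.1 hj).2).comp hsz
  have hG : ContDiff ℝ (⊤ : ℕ∞) fun q : (ℝ × E × E) × ℝ =>
      rhsF F Ft k q.1.1 (q.1.2.1 + hpoly l (fun j => ySeq F l j q.1.1 q.1.2.1) q.2 + q.2 ^ l • q.1.2.2) q.2
        - hpoly l (fun j => yI F l j q.1.1 q.1.2.1) q.2 := by
    refine ContDiff.sub ?_ ?_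
    · unfold rhsF
      refine ContDiff.add (ContDiff.sum fun i hi => ContDiff.smul (by fun_prop) ?_) (ContDiff.smul (by fun_prop) ?_)
      · exact (hF i hi).comp (ContDiff.prodMk (by fun_prop) hX)
      · exact hFt.comp (ContDiff.prodMk (by fun_prop) (ContDiff.prodMk hX (by fun_prop)))
    · unfold hpoly
      refine ContDiff.sum fun j hj => ContDiff.smul (by fun_prop) ?_
      have hj' := Finset.mem_Icc.1 hj
      exact (contDiff_yI F k l j hF hj'.1 (by omega) (by omega) hy).comp hsz
  obtain ⟨N, hN, h⟩ := hadamard (l + 1) _ hG (fun u => key_bigO F Ft k l hl1 hlk hF hFt u.1 u.2.1 u.2.2)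
  exact ⟨N, hN, fun s z w e => h (s, z, w) e⟩

theorem fixed_point (T : ℝ) (hT : 0 < T) (g : E → E) (a : E) (A : E ≃L[ℝ] E)
    (hg : HasStrictFDerivAt g (A : E →L[ℝ] E) a) (ga : g a = 0)
    (N : (ℝ × E × E) × ℝ → E) (hN : ContDiff ℝ (⊤ : ℕ∞) N) (r0 : ℝ) (hr0 : 0 < r0) :
    ∃ ε₁ > 0, ε₁ ≤ 1 ∧ ∃ C : ℝ, ∀ e : ℝ, |e| < ε₁ → ∃ (z : E) (w : ℝ → E), Continuous w ∧ ‖z - a‖ ≤ C * |e| ∧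
      ‖z - a‖ ≤ r0 ∧ (∀ t, ‖w t‖ ≤ 1) ∧ (∀ t ∈ Icc 0 T, w t = e • ∫ s in (0:ℝ)..t, N ((s, z, w s), e)) ∧
      g z + w T = 0 := by
  set A' : E →L[ℝ] E := (A.symm : E →L[ℝ] E) with hA'
  set c : ℝ := ‖A'‖ with hc
  have hc0 : 0 ≤ c := norm_nonneg _
  obtain ⟨r, hr, hrr0, hgr⟩ : ∃ r > 0, r ≤ r0 ∧ ∀ x ∈ Metric.closedBall a r, ∀ y ∈ Metric.closedBall a r,
      ‖(x - A' (g x)) - (y - A' (g y))‖ ≤ (1/4) * ‖x - y‖ := by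
    have h1 := hg.isLittleO.bound (show 0 < 1 / (4 * (c + 1)) by positivity)
    rw [Metric.eventually_nhds_iff_ball] at h1
    obtain ⟨δ, hδ, h2⟩ := h1
    refine ⟨min r0 (δ/2), by positivity, min_le_left _ _, fun x hx y hy => ?_⟩
    have hmem : (x, y) ∈ Metric.ball (a, a) δ := by
      rw [Metric.mem_ball, Prod.dist_eq]
      have := min_le_right r0 (δ/2)
      rw [Metric.mem_closedBall] at hx hy
      apply max_lt <;> simp only <;> linarith
    have h3 := h2 _ hmem
    simp only at h3
    have h4 : (x - A' (g x)) - (y - A' (g y)) = - A' (g x - g y - A (x - y)) := by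
      have : A' (A (x - y)) = x - y := A.symm_apply_apply _
      rw [map_sub A' _ (A (x - y)), this, map_sub]
      abel
    rw [h4, norm_neg]
    calc _ ≤ c * ‖g x - g y - A (x - y)‖ := A'.le_opNorm _
      _ ≤ c * (1 / (4 * (c + 1)) * ‖x - y‖) := by gcongr; exact h3
      _ = (c / (c + 1)) * ((1/4) * ‖x - y‖) := by field_simp
      _ ≤ 1 * ((1/4) * ‖x - y‖) := by
        gcongr
        rw [div_le_one (by positivity)]; linarith
      _ = _ := one_mul _
  set K : Set ((ℝ × E × E) × ℝ) := (Icc 0 T ×ˢ Metric.closedBall a r ×ˢ Metric.closedBall 0 1) ×ˢ Icc (-1) 1 with hK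
  have hKc : IsCompact K := (isCompact_Icc.prod ((isCompact_closedBall a r).prod (isCompact_closedBall 0 1))).prod isCompact_Icc
  have hKconv : Convex ℝ K := ((convex_Icc _ _).prod ((convex_closedBall a r).prod (convex_closedBall 0 1))).prod (convex_Icc _ _)
  obtain ⟨M, hM⟩ := hKc.exists_bound_of_continuousOn hN.continuous.continuousOn
  obtain ⟨L, hL⟩ : ∃ L, LipschitzOnWith L N K :=
    ContDiffOn.exists_lipschitzOnWith (n := (⊤:ℕ∞)) hN.contDiffOn (by simp) hKconv hKc
  have hM0 : 0 ≤ M := by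
    have : ((0, a, 0), 0) ∈ K := by
      simp [hK, hT.le, hr.le]
    exact (norm_nonneg _).trans (hM _ this)
  set q : ℝ := (c + 1) * T * (M + L + 1) with hq
  have hL0 : (0:ℝ) ≤ L := L.2
  have hq0 : 0 < q := by positivity
  have hm0 : 0 < min r 1 := by positivity
  refine ⟨min 1 (min r 1 / (4 * q)), by positivity, min_le_left _ _, 2 * (c * (T * M)), ?_⟩
  intro e he
  have he1 : |e| ≤ 1 := (he.trans_le (min_le_left _ _)).le
  have heq : |e| * q ≤ min r 1 / 4 := by
    have := (he.trans_le (min_le_right _ _)).le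
    rw [le_div_iff₀ (by positivity)] at this
    linarith
  have hee : e ∈ Icc (-1:ℝ) 1 := abs_le.1 he1
  have heTM : |e| * (T * M) ≤ |e| * q := by
    gcongr
    rw [hq, mul_assoc]
    calc T * M = 1 * (T * M) := by ring
      _ ≤ (c + 1) * (T * (M + L + 1)) := by gcongr <;> linarith
  have heTL : |e| * (T * L) ≤ |e| * q := by
    gcongr
    rw [hq, mul_assoc]
    calc T * L = 1 * (T * L) := by ring
      _ ≤ (c + 1) * (T * (M + L + 1)) := by gcongr <;> linarith
  have hceTM : c * (|e| * (T * M)) ≤ |e| * q := by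
    calc c * (|e| * (T * M)) = |e| * (c * T * M) := by ring
      _ ≤ _ := by rw [hq]; gcongr <;> linarith
  have hceTL : c * (|e| * (T * L)) ≤ |e| * q := by
    calc c * (|e| * (T * L)) = |e| * (c * T * L) := by ring
      _ ≤ _ := by rw [hq]; gcongr <;> linarith
  have hmr := min_le_left r 1
  have hm1 := min_le_right r 1
  let ext : C(Icc (0:ℝ) T, E) → ℝ → E := fun w => IccExtend hT.le w
  have hext_cont : ∀ w, Continuous (ext w) := fun w => w.continuous.Icc_extend'
  have hext_norm : ∀ w : C(Icc (0:ℝ) T, E), ∀ t, ‖ext w t‖ ≤ ‖w‖ := fun w t => w.norm_coe_le_norm _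
  have hext_dist : ∀ w w' : C(Icc (0:ℝ) T, E), ∀ t, dist (ext w t) (ext w' t) ≤ dist w w' :=
    fun w w' t => ContinuousMap.dist_apply_le_dist _
  have hint_cont : ∀ (z : E) (w : C(Icc (0:ℝ) T, E)), Continuous fun s => N ((s, z, ext w s), e) := by
    intro z w
    have := hext_cont w
    exact hN.continuous.comp (by fun_prop)
  let W : E × C(Icc (0:ℝ) T, E) → C(Icc (0:ℝ) T, E) := fun p =>
    ⟨fun t => e • ∫ s in (0:ℝ)..t, N ((s, p.1, ext p.2 s), e), by
      have := intervalIntegral.continuous_primitive (fun a b => (hint_cont p.1 p.2).intervalIntegrable a b (μ := MeasureTheory.volume)) 0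
      fun_prop⟩
  let Tt : Icc (0:ℝ) T := ⟨T, hT.le, le_rfl⟩
  let Ψ : E × C(Icc (0:ℝ) T, E) → E × C(Icc (0:ℝ) T, E) := fun p =>
    (p.1 - A' (g p.1 + W p Tt), W p)
  let S : Set (E × C(Icc (0:ℝ) T, E)) := Metric.closedBall a r ×ˢ Metric.closedBall 0 1
  have hmemK : ∀ p ∈ S, ∀ s ∈ Icc 0 T, ((s, p.1, ext p.2 s), e) ∈ K := by
    rintro p ⟨hp1, hp2⟩ s hs
    refine ⟨⟨hs, hp1, ?_⟩, hee⟩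
    rw [mem_closedBall_zero_iff] at hp2 ⊢
    exact (hext_norm _ _).trans hp2
  have hWbound : ∀ p ∈ S, ∀ t, ‖W p t‖ ≤ |e| * (T * M) := by
    intro p hp t
    change ‖e • ∫ s in (0:ℝ)..t, N ((s, p.1, ext p.2 s), e)‖ ≤ _
    rw [norm_smul, Real.norm_eq_abs]
    gcongr
    have := intervalIntegral.norm_integral_le_of_norm_le_const (a := 0) (b := t) (f := fun s => N ((s, p.1, ext p.2 s), e)) (C := M) ?_
    · refine this.trans ?_
      rw [sub_zero, abs_of_nonneg t.2.1, mul_comm]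
      gcongr
      exact t.2.2
    · intro s hs
      rw [uIoc_of_le t.2.1] at hs
      exact hM _ (hmemK p hp s ⟨hs.1.le, hs.2.trans t.2.2⟩)
  have hWlip : ∀ p ∈ S, ∀ p' ∈ S, ∀ t, dist (W p t) (W p' t) ≤ |e| * (T * L) * dist p p' := by
    intro p hp p' hp' t
    change dist (e • ∫ s in (0:ℝ)..t, N ((s, p.1, ext p.2 s), e)) (e • ∫ s in (0:ℝ)..t, N ((s, p'.1, ext p'.2 s), e)) ≤ _
    rw [dist_smul₀, Real.norm_eq_abs, dist_eq_norm, ← intervalIntegral.integral_sub ((hint_cont _ _).intervalIntegrable _ _) ((hint_cont _ _).intervalIntegrable _ _), mul_assoc]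
    gcongr
    have := intervalIntegral.norm_integral_le_of_norm_le_const (a := 0) (b := t) (f := fun s => N ((s, p.1, ext p.2 s), e) - N ((s, p'.1, ext p'.2 s), e)) (C := L * dist p p') ?_
    · refine this.trans ?_
      rw [sub_zero, abs_of_nonneg t.2.1, mul_comm, ← mul_assoc]
      gcongr
      exact t.2.2
    · intro s hs
      rw [uIoc_of_le t.2.1] at hs
      have hs' : s ∈ Icc 0 T := ⟨hs.1.le, hs.2.trans t.2.2⟩
      rw [← dist_eq_norm]
      refine (hL.dist_le_mul _ (hmemK p hp s hs') _ (hmemK p' hp' s hs')).trans ?_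
      gcongr
      simp only [Prod.dist_eq, dist_self]
      have h1 : dist p.1 p'.1 ≤ max (dist p.1 p'.1) (dist p.2 p'.2) := le_max_left _ _
      have h2 : dist (ext p.2 s) (ext p'.2 s) ≤ max (dist p.1 p'.1) (dist p.2 p'.2) := (hext_dist _ _ _).trans (le_max_right _ _)
      have h0 : 0 ≤ max (dist p.1 p'.1) (dist p.2 p'.2) := dist_nonneg.trans h1
      exact max_le (max_le h0 (max_le h1 h2)) h0
  have haS : a ∈ Metric.closedBall a r := Metric.mem_closedBall_self hr.le
  have hest : ∀ p ∈ S, ‖p.1 - A' (g p.1 + W p Tt) - a‖ ≤ (1/4) * ‖p.1 - a‖ + c * (|e| * (T * M)) := by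
    intro p hp
    have h1 := hgr p.1 hp.1 a haS
    have h2 : p.1 - A' (g p.1 + W p Tt) - a = ((p.1 - A' (g p.1)) - (a - A' (g a))) - A' (W p Tt) := by
      rw [ga, map_zero, map_add]; abel
    rw [h2]
    refine (norm_sub_le _ _).trans (add_le_add h1 ?_)
    exact (A'.le_opNorm _).trans (by gcongr; exact hWbound p hp Tt)
  have hmaps : MapsTo Ψ S S := by
    intro p hp
    refine ⟨?_, ?_⟩
    · rw [Metric.mem_closedBall, dist_eq_norm]
      refine (hest p hp).trans ?_
      have := hp.1
      rw [Metric.mem_closedBall, dist_eq_norm] at this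
      linarith
    · rw [mem_closedBall_zero_iff, ContinuousMap.norm_le _ zero_le_one]
      intro t
      exact (hWbound p hp t).trans (by linarith)
  have hcontr : ContractingWith (1/2) (hmaps.restrict Ψ S S) := by
    refine ⟨by rw [div_lt_one (by norm_num)]; norm_num, LipschitzWith.of_dist_le_mul ?_⟩
    rintro ⟨p, hp⟩ ⟨p', hp'⟩
    change dist (Ψ p) (Ψ p') ≤ _ * dist p p'
    have hd : 0 ≤ dist p p' := dist_nonneg
    have hd1 : dist p.1 p'.1 ≤ dist p p' := le_max_left _ _
    have hcast : (((1/2 : NNReal)) : ℝ) = 1/2 := by simp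
    rw [hcast, Prod.dist_eq]
    refine max_le ?_ ?_
    · change dist (p.1 - A' (g p.1 + W p Tt)) (p'.1 - A' (g p'.1 + W p' Tt)) ≤ _
      have h2 : (p.1 - A' (g p.1 + W p Tt)) - (p'.1 - A' (g p'.1 + W p' Tt)) = ((p.1 - A' (g p.1)) - (p'.1 - A' (g p'.1))) - A' (W p Tt - W p' Tt) := by
        rw [map_add, map_add, map_sub]; abel
      rw [dist_eq_norm, h2]
      refine (norm_sub_le _ _).trans ?_
      have h3 := hgr p.1 hp.1 p'.1 hp'.1
      have h4 : ‖A' (W p Tt - W p' Tt)‖ ≤ c * (|e| * (T * L) * dist p p') := by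
        refine (A'.le_opNorm _).trans ?_
        gcongr
        rw [← dist_eq_norm]
        exact hWlip p hp p' hp' Tt
      rw [← dist_eq_norm p.1] at h3
      have h5 : c * (|e| * (T * L) * dist p p') ≤ 1/4 * dist p p' := by
        rw [← mul_assoc]
        gcongr
        linarith
      linarith
    · rw [ContinuousMap.dist_le (by positivity)]
      intro t
      refine (hWlip p hp p' hp' t).trans ?_
      gcongr
      linarith
  have hcomp : IsComplete S := (Metric.isClosed_closedBall.prod Metric.isClosed_closedBall).isComplete
  obtain ⟨p, hpS, hfix, -⟩ := hcontr.exists_fixedPoint' hcomp hmaps (x := (a, 0)) ⟨haS, by simp⟩ (edist_ne_top _ _)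
  have hfix1 : p.1 - A' (g p.1 + W p Tt) = p.1 := congrArg Prod.fst hfix
  have hfix2 : W p = p.2 := congrArg Prod.snd hfix
  have hest' := hest p hpS
  rw [hfix1] at hest'
  have hpa : ‖p.1 - a‖ ≤ r := by simpa [dist_eq_norm] using hpS.1
  have hp2 : ‖p.2‖ ≤ 1 := by simpa using hpS.2
  refine ⟨p.1, ext p.2, hext_cont _, ?_, hpa.trans hrr0, fun t => (hext_norm _ t).trans hp2, ?_, ?_⟩
  · have := norm_nonneg (p.1 - a)
    have h2 : 2 * (c * (T * M)) * |e| = 2 * (c * (|e| * (T * M))) := by ring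
    rw [h2]
    nlinarith
  · intro t ht
    have h1 : ext p.2 t = p.2 ⟨t, ht⟩ := IccExtend_of_mem _ _ ht
    have h2 : W p ⟨t, ht⟩ = p.2 ⟨t, ht⟩ := by rw [hfix2]
    rw [h1, ← h2]
    rfl
  · have h1 : ext p.2 T = p.2 Tt := IccExtend_of_mem _ _ _
    have h2 : A' (g p.1 + W p Tt) = 0 := by
      rwa [sub_eq_self] at hfix1
    rw [h1, ← hfix2]
    exact (A.symm.map_eq_zero_iff).1 h2

end fixsec
section persec
variable {E : Type} [NormedAddCommGroup E] [NormedSpace ℝ E] [CompleteSpace E]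

theorem periodic_ext (T : ℝ) (hT : 0 < T) (f : ℝ → E → E) (hf : Continuous fun q : ℝ × E => f q.1 q.2)
    (hper : ∀ t y, f (t + T) y = f t y) (x : ℝ → E) (hx : Continuous x)
    (hsol : ∀ t ∈ Icc 0 T, x t = x 0 + ∫ s in (0:ℝ)..t, f s (x s)) (hxT : x T = x 0) :
    ∃ φ : ℝ → E, (∀ t, HasDerivAt φ (f t (φ t)) t) ∧ (∀ t, φ (t + T) = φ t) ∧ φ 0 = x 0 ∧
      ∀ t, ∃ t' ∈ Icc 0 T, φ t = x t' := by
  have : Fact (0 < T) := ⟨hT⟩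
  set u : ℝ → E := fun t => AddCircle.liftIco T 0 x (t : AddCircle T) with hu
  have hucont : Continuous u := by
    refine (AddCircle.liftIco_continuous (p := T) (a := 0) (f := x) (by rw [zero_add, hxT]) hx.continuousOn).comp ?_
    exact AddCircle.continuous_mk' T
  have huper : Function.Periodic u T := by
    intro t
    simp only [hu, AddCircle.coe_add_period]
  have hueq : ∀ t ∈ Icc 0 T, u t = x t := by
    intro t ht
    rcases ht.2.lt_or_eq with h | h
    · exact AddCircle.liftIco_coe_apply (p := T) (a := 0) (by rw [zero_add]; exact ⟨ht.1, h⟩)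
    · rw [h, hxT]
      have : u T = u 0 := by simpa using huper 0
      rw [this]
      exact AddCircle.liftIco_coe_apply (p := T) (a := 0) (by rw [zero_add]; exact ⟨le_rfl, hT⟩)
  set h : ℝ → E := fun s => f s (u s) with hh
  have hhcont : Continuous h := hf.comp (by fun_prop : Continuous fun s => (s, u s))
  have hhper : Function.Periodic h T := by
    intro t
    simp only [hh, hper, huper t]
  have hxint : ∀ t ∈ Icc 0 T, x t = x 0 + ∫ s in (0:ℝ)..t, h s := by
    intro t ht
    rw [hsol t ht]
    congr 1
    refine intervalIntegral.integral_congr fun s hs => ?_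
    rw [uIcc_of_le ht.1] at hs
    simp only [hh, hueq s ⟨hs.1, hs.2.trans ht.2⟩]
  have hzero : ∫ s in (0:ℝ)..T, h s = 0 := by
    have := hxint T ⟨hT.le, le_rfl⟩
    rw [hxT] at this
    exact left_eq_add.1 this
  set φ : ℝ → E := fun t => x 0 + ∫ s in (0:ℝ)..t, h s with hφ
  have hφper : Function.Periodic φ T := by
    intro t
    simp only [hφ]
    congr 1
    rw [← intervalIntegral.integral_add_adjacent_intervals (hhcont.intervalIntegrable 0 t) (hhcont.intervalIntegrable t (t + T)),
      hhper.intervalIntegral_add_eq t 0, zero_add, hzero, add_zero]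
  have hφu : ∀ t, φ t = u t := by
    intro t
    have hp : Function.Periodic (fun t => φ t - u t) T := by
      intro t
      simp only [hφper t, huper t]
    obtain ⟨y, hy, hy2⟩ := hp.exists_mem_Ico₀ hT t
    have hyI : y ∈ Icc 0 T := ⟨hy.1, hy.2.le⟩
    have : φ y - u y = 0 := by
      rw [hueq y hyI, hxint y hyI, sub_self]
    rw [this] at hy2
    exact sub_eq_zero.1 hy2
  refine ⟨φ, fun t => ?_, hφper, by simp [hφ], fun t => ?_⟩
  · rw [hφu t]
    exact ((hhcont.integral_hasStrictDerivAt 0 t).hasDerivAt).const_add (x 0)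
  · obtain ⟨y, hy, hy2⟩ := huper.exists_mem_Ico₀ hT t
    have hyI : y ∈ Icc 0 T := ⟨hy.1, hy.2.le⟩
    exact ⟨y, hyI, by rw [hφu, hy2, hueq y hyI]⟩

end persec
theorem cont_cs {X E : Type} [TopologicalSpace X] [NormedAddCommGroup E] [NormedSpace ℝ E] {f : X → E}
    (hf : Continuous f) (c : ℝ) : Continuous fun t => c • f t := hf.const_smul c

open Bornology Metric

/-- **Theorem A.2 of the paper** (Theorem of [LNT]): if the first `l-1` averaged
functions vanish identically and `a*` is a simple zero of the `l`-th averaged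
function `g_l`, then for `|ε| > 0` small the system
`ẋ = ∑_{i=1}^{k} εⁱ Fᵢ(t,x) + ε^{k+1} F̃(t,x,ε)` has a `T`-periodic solution
`φ(·,ε)` with `φ(0,ε) → a*` as `ε → 0`. -/
theorem higher_order_averaging_periodic_solution
    (n k : ℕ) (hk : 1 ≤ k) (T ε₀ : ℝ) (hT : 0 < T) (hε₀ : 0 < ε₀)
    (Ω : Set (Fin n → ℝ)) (hΩ : IsOpen Ω) (hΩb : IsBounded Ω)
    (F : ℕ → ℝ → (Fin n → ℝ) → Fin n → ℝ) (Ft : ℝ → (Fin n → ℝ) → ℝ → Fin n → ℝ)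
    (hF : ∀ i ∈ Finset.Icc 1 k, ContDiff ℝ (⊤ : ℕ∞) fun w : ℝ × (Fin n → ℝ) => F i w.1 w.2)
    (hFt : ContDiff ℝ (⊤ : ℕ∞) fun w : ℝ × (Fin n → ℝ) × ℝ => Ft w.1 w.2.1 w.2.2)
    (hFper : ∀ i ∈ Finset.Icc 1 k, ∀ (t : ℝ) (x : Fin n → ℝ), F i (t + T) x = F i t x)
    (hFtper : ∀ (t : ℝ) (x : Fin n → ℝ) (ε : ℝ), Ft (t + T) x ε = Ft t x ε)
    -- `g_i ≡ 0` for `i = 1, …, l-1` and `g_l ≢ 0`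
    (l : ℕ) (hl : l ∈ Finset.Icc 1 k)
    (hvanish : ∀ i, 1 ≤ i → i < l → ∀ x ∈ Ω, avgFun F T i x = 0)
    (hnonvanish : ∃ x ∈ Ω, avgFun F T l x ≠ 0)
    -- `a*` is a simple zero of `g_l`
    (astar : Fin n → ℝ) (hastar : astar ∈ Ω)
    (hzero : avgFun F T l astar = 0)
    (hdet : LinearMap.det (fderiv ℝ (avgFun F T l) astar).toLinearMap ≠ 0) :
    ∃ ε₁ : ℝ, 0 < ε₁ ∧
      ∃ φ : ℝ → ℝ → Fin n → ℝ,
        (∀ ε : ℝ, 0 < |ε| → |ε| < ε₁ →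
          (∀ t : ℝ, φ t ε ∈ Ω) ∧
          (∀ t : ℝ, HasDerivAt (fun s => φ s ε)
            ((∑ i ∈ Finset.Icc 1 k, ε ^ i • F i t (φ t ε)) +
              ε ^ (k + 1) • Ft t (φ t ε) ε) t) ∧
          ∀ t : ℝ, φ (t + T) ε = φ t ε) ∧
        Tendsto (fun ε => φ 0 ε) (𝓝[≠] (0 : ℝ)) (𝓝 astar) := by
  obtain ⟨hl1, hlk⟩ := Finset.mem_Icc.1 hl
  have hy := contDiff_ySeq F k hF l hlk
  obtain ⟨N, hN, hNeq⟩ := exists_remainder F Ft k l hl1 hlk hF hFt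
  have hg : ContDiff ℝ (⊤ : ℕ∞) (avgFun F T l) := by
    unfold avgFun
    exact ContDiff.const_smul _ ((hy l le_rfl).comp (by fun_prop : ContDiff ℝ (⊤ : ℕ∞) fun x : Fin n → ℝ => (T, x)))
  set A : (Fin n → ℝ) ≃L[ℝ] (Fin n → ℝ) :=
    ContinuousLinearMap.toContinuousLinearEquivOfDetNeZero (fderiv ℝ (avgFun F T l) astar) hdet with hA
  have hgs : HasStrictFDerivAt (avgFun F T l) (A : (Fin n → ℝ) →L[ℝ] (Fin n → ℝ)) astar := by
    have h1 : (A : (Fin n → ℝ) →L[ℝ] (Fin n → ℝ)) = fderiv ℝ (avgFun F T l) astar :=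
      ContinuousLinearMap.coe_toContinuousLinearEquivOfDetNeZero _ _
    rw [h1]
    exact hg.contDiffAt.hasStrictFDerivAt (by simp)
  obtain ⟨ρ, hρ, hρΩ⟩ := Metric.nhds_basis_closedBall.mem_iff.1 (hΩ.mem_nhds hastar)
  obtain ⟨ε₁, hε₁, hε₁1, C, hfix⟩ := fixed_point T hT (avgFun F T l) astar A hgs hzero N hN (ρ / 2) (by positivity)
  -- bound for the approximate solution
  obtain ⟨M, hM⟩ := (isCompact_Icc.prod (isCompact_closedBall astar (ρ / 2))).exists_bound_of_continuousOn
    (s := Icc (0:ℝ) T ×ˢ Metric.closedBall astar (ρ / 2))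
    (f := fun q : ℝ × (Fin n → ℝ) => ∑ j ∈ Finset.Icc 1 l, ((j.factorial : ℝ))⁻¹ * ‖ySeq F l j q.1 q.2‖)
    (Continuous.continuousOn (continuous_finsetSum _ fun j hj =>
      continuous_const.mul (hy j (Finset.mem_Icc.1 hj).2).continuous.norm))
  have hM0 : 0 ≤ M := (norm_nonneg _).trans (hM (0, astar) ⟨⟨le_rfl, hT.le⟩, Metric.mem_closedBall_self (by positivity)⟩)
  have hmain : ∀ e : ℝ, |e| < min ε₁ (ρ / (2 * (M + 1))) → ∃ φ : ℝ → Fin n → ℝ,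
      ((∀ t : ℝ, φ t ∈ Ω) ∧ (∀ t : ℝ, HasDerivAt φ (rhsF F Ft k t (φ t) e) t) ∧
        ∀ t : ℝ, φ (t + T) = φ t) ∧ ‖φ 0 - astar‖ ≤ C * |e| := by
    intro e he
    have he1 : |e| < ε₁ := he.trans_le (min_le_left _ _)
    have he1' : |e| ≤ 1 := by linarith
    have he2 : |e| * (M + 1) ≤ ρ / 2 := by
      have := (he.trans_le (min_le_right _ _)).le
      rw [le_div_iff₀ (by positivity)] at this
      linarith
    obtain ⟨z, w, hw, hzC, hzρ, hw1, hweq, hgw⟩ := hfix e he1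
    have hzball : z ∈ Metric.closedBall astar (ρ / 2) := by
      rw [Metric.mem_closedBall, dist_eq_norm]; exact hzρ
    have hzΩ : z ∈ Ω := hρΩ (Metric.closedBall_subset_closedBall (by linarith) hzball)
    have hyc : ∀ j ∈ Finset.Icc 1 l, Continuous fun s => ySeq F l j s z := fun j hj =>
      (hy j (Finset.mem_Icc.1 hj).2).continuous.comp (by fun_prop : Continuous fun s : ℝ => (s, z))
    have hyIc : ∀ j ∈ Finset.Icc 1 l, Continuous fun s => yI F l j s z := fun j hj =>
      (contDiff_yI F k l j hF (Finset.mem_Icc.1 hj).1 ((Finset.mem_Icc.1 hj).2.trans hlk)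
        ((Finset.mem_Icc.1 hj).2.trans (Nat.le_succ l)) hy).continuous.comp (by fun_prop : Continuous fun s : ℝ => (s, z))
    set x : ℝ → Fin n → ℝ := fun t => z + hpoly l (fun j => ySeq F l j t z) e + e ^ l • w t with hxdef
    have hxc : Continuous x := by
      refine Continuous.add (Continuous.add continuous_const ?_) (cont_cs hw _)
      unfold hpoly
      exact continuous_finsetSum _ fun j hj => cont_cs (hyc j hj) _
    have hx0 : x 0 = z := by
      have h1 : hpoly l (fun j => ySeq F l j 0 z) e = 0 := by
        unfold hpoly
        refine Finset.sum_eq_zero fun j hj => ?_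
        beta_reduce
        rw [ySeq_eq F l j (Finset.mem_Icc.1 hj).1 (Finset.mem_Icc.1 hj).2, intervalIntegral.integral_same, smul_zero]
      have h2 : w 0 = 0 := by
        rw [hweq 0 ⟨le_rfl, hT.le⟩, intervalIntegral.integral_same, smul_zero]
      simp only [hxdef, h1, h2, smul_zero, add_zero]
    have hrhs : ∀ s, rhsF F Ft k s (x s) e = hpoly l (fun j => yI F l j s z) e + e ^ (l + 1) • N ((s, z, w s), e) := by
      intro s
      rw [← hNeq s z (w s) e]
      simp only [hxdef]
      abel
    have hNc : Continuous fun s => N ((s, z, w s), e) := hN.continuous.comp (by fun_prop)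
    have hsol : ∀ t ∈ Icc 0 T, x t = x 0 + ∫ s in (0:ℝ)..t, rhsF F Ft k s (x s) e := by
      intro t ht
      rw [hx0]
      simp only [hrhs]
      have hterm : ∀ j ∈ Finset.Icc 1 l, Continuous fun s => (e ^ j * ((j.factorial : ℝ))⁻¹) • yI F l j s z := fun j hj =>
        cont_cs (hyIc j hj) _
      have hpc : Continuous fun s => hpoly l (fun j => yI F l j s z) e := by
        unfold hpoly
        exact continuous_finsetSum _ hterm
      rw [intervalIntegral.integral_add (hpc.intervalIntegrable _ _) ((cont_cs hNc _).intervalIntegrable _ _),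
        intervalIntegral.integral_smul]
      have h1 : ∫ s in (0:ℝ)..t, hpoly l (fun j => yI F l j s z) e = hpoly l (fun j => ySeq F l j t z) e := by
        unfold hpoly
        rw [intervalIntegral.integral_finsetSum fun j hj => (hterm j hj).intervalIntegrable _ _]
        refine Finset.sum_congr rfl fun j hj => ?_
        beta_reduce
        rw [intervalIntegral.integral_smul, ySeq_eq F l j (Finset.mem_Icc.1 hj).1 (Finset.mem_Icc.1 hj).2]
      rw [h1, pow_succ, mul_smul, ← hweq t ht, ← add_assoc]
    have hxT : x T = x 0 := by
      rw [hx0]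
      have h1 : hpoly l (fun j => ySeq F l j T z) e = e ^ l • avgFun F T l z := by
        unfold hpoly
        rw [Finset.sum_eq_single_of_mem l (Finset.mem_Icc.2 ⟨hl1, le_rfl⟩), mul_smul]
        · rfl
        · intro j hj hjl
          have hj' := Finset.mem_Icc.1 hj
          have h2 := hvanish j hj'.1 (by omega) z hzΩ
          unfold avgFun at h2
          beta_reduce
          rw [ySeq_stable F l j hj'.2, mul_smul, h2, smul_zero]
      simp only [hxdef, h1]
      rw [add_assoc, ← smul_add, hgw, smul_zero, add_zero]
    have hxΩ : ∀ t ∈ Icc 0 T, x t ∈ Ω := by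
      intro t ht
      apply hρΩ
      rw [Metric.mem_closedBall, dist_eq_norm]
      have h1 : ‖hpoly l (fun j => ySeq F l j t z) e‖ ≤ |e| * M := by
        have h2 := (le_abs_self _).trans (hM (t, z) ⟨ht, hzball⟩)
        simp only at h2
        refine le_trans ?_ (mul_le_mul_of_nonneg_left h2 (abs_nonneg e))
        unfold hpoly
        rw [Finset.mul_sum]
        refine norm_sum_le_of_le _ fun j hj => ?_
        rw [norm_smul, norm_mul, norm_pow, norm_inv, Real.norm_natCast, Real.norm_eq_abs, mul_assoc]
        gcongr
        exact pow_le_of_le_one (abs_nonneg e) he1' (by have := (Finset.mem_Icc.1 hj).1; omega)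
      have h3 : ‖e ^ l • w t‖ ≤ |e| * 1 := by
        rw [norm_smul, norm_pow, Real.norm_eq_abs]
        gcongr
        · exact pow_le_of_le_one (abs_nonneg e) he1' (by omega)
        · exact hw1 t
      have h4 : x t - astar = (z - astar) + hpoly l (fun j => ySeq F l j t z) e + e ^ l • w t := by
        simp only [hxdef]; abel
      rw [h4]
      refine (norm_add₃_le).trans ?_
      linarith
    have hfc : Continuous fun q : ℝ × (Fin n → ℝ) => rhsF F Ft k q.1 q.2 e := by
      unfold rhsF
      refine Continuous.add (continuous_finsetSum _ fun i hi => cont_cs (hF i hi).continuous _) (cont_cs ?_ _)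
      exact hFt.continuous.comp (by fun_prop : Continuous fun q : ℝ × (Fin n → ℝ) => (q.1, q.2, e))
    have hfper : ∀ t y, rhsF F Ft k (t + T) y e = rhsF F Ft k t y e := by
      intro t y
      unfold rhsF
      rw [hFtper, Finset.sum_congr rfl fun i hi => by rw [hFper i hi]]
    obtain ⟨φ, h1, h2, h3, h4⟩ := periodic_ext T hT (fun t y => rhsF F Ft k t y e) hfc hfper x hxc hsol hxT
    refine ⟨φ, ⟨fun t => ?_, h1, h2⟩, ?_⟩
    · obtain ⟨t', ht', heq⟩ := h4 t
      rw [heq]; exact hxΩ t' ht'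
    · rw [h3, hx0]; exact hzC
  have hpos : 0 < min ε₁ (ρ / (2 * (M + 1))) := by positivity
  choose! φ hφ1 hφ2 using hmain
  refine ⟨_, hpos, fun t e => φ e t, fun e _ he => hφ1 e he, ?_⟩
  rw [tendsto_iff_norm_sub_tendsto_zero]
  have hC : Tendsto (fun e : ℝ => C * |e|) (𝓝[≠] 0) (𝓝 0) := by
    have : Continuous fun e : ℝ => C * |e| := by fun_prop
    have h := this.tendsto 0
    simp only [abs_zero, mul_zero] at h
    exact h.mono_left nhdsWithin_le_nhds
  refine squeeze_zero' (Eventually.of_forall fun _ => norm_nonneg _) ?_ hC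
  refine nhdsWithin_le_nhds ?_
  filter_upwards [Metric.ball_mem_nhds (0:ℝ) hpos] with e he
  exact hφ2 e (by simpa using he)

end
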